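/- arXiv:2212.08422 — 2 statements merged into one kernel-verified Lean document; each statement's English description precedes it below -/
import Mathlib

section
/- Let δ ≥ 1 and m ≥ δ+1 be integers and let 𝒯, 𝒯' be triangulations of the cyclic polytope C(m, δ). Then 𝒯 ≤₂ 𝒯' if and only if every (⌈δ/2⌉+1)-element subset A of {1, …, m} such that |A|_δ is submerged by 𝒯 also has |A|_δ submerged by 𝒯'. -/
open Finset

noncomputable section

/-- The moment curve `p_δ(t) = (t, t², …, t^δ)` in `ℝ^δ`. -/
def momCurve (δ : ℕ) (t : ℝ) : Fin δ → ℝ := fun i => t ^ (i.1 + 1)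

/-- The points `p_δ(a)` on the moment curve for `a` ranging over a finite set of naturals. -/
def momPts (δ : ℕ) (A : Finset ℕ) : Set (Fin δ → ℝ) :=
  (fun a : ℕ => momCurve δ (a : ℝ)) '' (A : Set ℕ)

/-- The simplex `|A|_δ`, i.e. the convex hull of the points `p_δ(a)`, `a ∈ A`. -/
def smp (δ : ℕ) (A : Finset ℕ) : Set (Fin δ → ℝ) := convexHull ℝ (momPts δ A)

/-- The cyclic polytope `C(m, δ) = conv{p_δ(1), …, p_δ(m)}`. -/
def cyc (m δ : ℕ) : Set (Fin δ → ℝ) := smp δ (Finset.Icc 1 m)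

/-- The last standard basis vector `e_δ` of `ℝ^δ`. -/
def eLast (δ : ℕ) : Fin δ → ℝ := fun i => if i.1 = δ - 1 then 1 else 0

/-- The last coordinate of a point of `ℝ^δ`. -/
def lastCoord {δ : ℕ} (x : Fin δ → ℝ) : ℝ :=
  if h : 0 < δ then x ⟨δ - 1, Nat.sub_lt h one_pos⟩ else 0

/-- `x` lies strictly above `V`: `x - r • e_δ ∈ V` for some `r > 0`. -/
def StrictlyAbove {δ : ℕ} (x : Fin δ → ℝ) (V : Set (Fin δ → ℝ)) : Prop :=
  ∃ r : ℝ, 0 < r ∧ x - r • eLast δ ∈ V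

/-- `x` lies strictly below `V`: `x - r • e_δ ∈ V` for some `r < 0`. -/
def StrictlyBelow {δ : ℕ} (x : Fin δ → ℝ) (V : Set (Fin δ → ℝ)) : Prop :=
  ∃ r : ℝ, r < 0 ∧ x - r • eLast δ ∈ V

/-- `|F|_δ` is a lower facet of the cyclic polytope `C(m, δ)`. -/
def IsLowerFacet (m δ : ℕ) (F : Finset ℕ) : Prop :=
  F ⊆ Finset.Icc 1 m ∧ F.card = δ ∧
    ∀ i ∈ Finset.Icc 1 m, i ∉ F →
      StrictlyAbove (momCurve δ (i : ℝ))
        ((affineSpan ℝ (momPts δ F) : AffineSubspace ℝ (Fin δ → ℝ)) : Set (Fin δ → ℝ))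

/-- `|F|_δ` is an upper facet of the cyclic polytope `C(m, δ)`. -/
def IsUpperFacet (m δ : ℕ) (F : Finset ℕ) : Prop :=
  F ⊆ Finset.Icc 1 m ∧ F.card = δ ∧
    ∀ i ∈ Finset.Icc 1 m, i ∉ F →
      StrictlyBelow (momCurve δ (i : ℝ))
        ((affineSpan ℝ (momPts δ F) : AffineSubspace ℝ (Fin δ → ℝ)) : Set (Fin δ → ℝ))

/-- The facet `|H ∖ {c}|_δ` of the simplex `|H|_δ` is a lower facet of `|H|_δ`. -/
def IsLowerFacetOfSimplex (δ : ℕ) (H : Finset ℕ) (c : ℕ) : Prop :=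
  c ∈ H ∧ StrictlyAbove (momCurve δ (c : ℝ))
    ((affineSpan ℝ (momPts δ (H.erase c)) : AffineSubspace ℝ (Fin δ → ℝ)) : Set (Fin δ → ℝ))

/-- The facet `|H ∖ {c}|_δ` of the simplex `|H|_δ` is an upper facet of `|H|_δ`. -/
def IsUpperFacetOfSimplex (δ : ℕ) (H : Finset ℕ) (c : ℕ) : Prop :=
  c ∈ H ∧ StrictlyBelow (momCurve δ (c : ℝ))
    ((affineSpan ℝ (momPts δ (H.erase c)) : AffineSubspace ℝ (Fin δ → ℝ)) : Set (Fin δ → ℝ))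

/-- `T` is a triangulation of the cyclic polytope `C(m, δ)`. -/
def IsTriangulation (m δ : ℕ) (T : Finset (Finset ℕ)) : Prop :=
  (∀ S ∈ T, S ⊆ Finset.Icc 1 m ∧ S.card = δ + 1) ∧
  (⋃ S ∈ T, smp δ S) = cyc m δ ∧
  ∀ S ∈ T, ∀ S' ∈ T, smp δ S ∩ smp δ S' = smp δ (S ∩ S')

/-- `A` is a face of the triangulation `T`. -/
def IsFace (T : Finset (Finset ℕ)) (A : Finset ℕ) : Prop := ∃ S ∈ T, A ⊆ S

/-- `A ≀ B`: writing `A = {a_0 < … < a_d}` and `B = {b_0 < … < b_d}`, we have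
`a_0 < b_0 < a_1 < b_1 < … < a_d < b_d`. -/
def Intertwines (d : ℕ) (A B : Finset ℕ) : Prop :=
  ∃ a b : Fin (d + 1) → ℕ, StrictMono a ∧ StrictMono b ∧
    A = Finset.image a Finset.univ ∧ B = Finset.image b Finset.univ ∧
    (∀ i, a i < b i) ∧ ∀ i : Fin d, b i.castSucc < a i.succ

/-- `y = ℓ_S(x)` is the lift of `x ∈ |S|_δ` to `ℝ^{δ+1}` given by the barycentric
coordinates of `x` with respect to the vertices of `|S|_δ`. -/
def IsLift (δ : ℕ) (S : Finset ℕ) (x : Fin δ → ℝ) (y : Fin (δ + 1) → ℝ) : Prop :=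
  ∃ w : ℕ → ℝ, (∀ a ∈ S, 0 ≤ w a) ∧ (∑ a ∈ S, w a) = 1 ∧
    (∑ a ∈ S, w a • momCurve δ (a : ℝ)) = x ∧
    (∑ a ∈ S, w a • momCurve (δ + 1) (a : ℝ)) = y

/-- `|A|_δ` is submerged by the triangulation `T`. -/
def Submerged (δ : ℕ) (T : Finset (Finset ℕ)) (A : Finset ℕ) : Prop :=
  ∀ S ∈ T, ∀ x ∈ smp δ A ∩ smp δ S, ∀ y y' : Fin (δ + 1) → ℝ,
    IsLift δ A x y → IsLift δ S x y' → lastCoord y ≤ lastCoord y'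

/-- `|A|_δ` is supermerged by the triangulation `T`. -/
def Supermerged (δ : ℕ) (T : Finset (Finset ℕ)) (A : Finset ℕ) : Prop :=
  ∀ S ∈ T, ∀ x ∈ smp δ A ∩ smp δ S, ∀ y y' : Fin (δ + 1) → ℝ,
    IsLift δ A x y → IsLift δ S x y' → lastCoord y' ≤ lastCoord y

/-- The second higher Stasheff–Tamari order `T ≤₂ T'`. -/
def HST2 (δ : ℕ) (T T' : Finset (Finset ℕ)) : Prop :=
  ∀ S ∈ T, ∀ S' ∈ T', ∀ x ∈ smp δ S ∩ smp δ S', ∀ y y' : Fin (δ + 1) → ℝ,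
    IsLift δ S x y → IsLift δ S' x y' → lastCoord y ≤ lastCoord y'

open scoped Classical in
/-- The lower triangulation of `C(m, δ)`: the collection of `(δ+1)`-element subsets `F` of
`{1, …, m}` such that `|F|_{δ+1}` is a lower facet of `C(m, δ+1)`. -/
def lowerTriang (m δ : ℕ) : Finset (Finset ℕ) :=
  (Finset.Icc 1 m).powerset.filter (fun F => IsLowerFacet m (δ + 1) F)

open scoped Classical in
/-- The upper triangulation of `C(m, δ)`. -/
def upperTriang (m δ : ℕ) : Finset (Finset ℕ) :=
  (Finset.Icc 1 m).powerset.filter (fun F => IsUpperFacet m (δ + 1) F)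

open scoped Classical in
/-- `L(H)`: the `(δ+1)`-element subsets `G` of `H` with `|G|_{δ+1}` a lower facet of the
simplex `|H|_{δ+1}`. -/
def LH (δ : ℕ) (H : Finset ℕ) : Finset (Finset ℕ) :=
  (H.filter (fun c => IsLowerFacetOfSimplex (δ + 1) H c)).image (fun c => H.erase c)

open scoped Classical in
/-- `U(H)`: the `(δ+1)`-element subsets `G` of `H` with `|G|_{δ+1}` an upper facet of the
simplex `|H|_{δ+1}`. -/
def UH (δ : ℕ) (H : Finset ℕ) : Finset (Finset ℕ) :=
  (H.filter (fun c => IsUpperFacetOfSimplex (δ + 1) H c)).image (fun c => H.erase c)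

/-- The lift relation, coordinate by coordinate. -/
lemma isLift_iff {δ : ℕ} {S : Finset ℕ} {x : Fin δ → ℝ} {y : Fin (δ + 1) → ℝ} :
    IsLift δ S x y ↔ ∃ w : ℕ → ℝ, (∀ a ∈ S, 0 ≤ w a) ∧ ∑ a ∈ S, w a = 1 ∧
      (∀ i : Fin δ, ∑ a ∈ S, w a * (a : ℝ) ^ (i.1 + 1) = x i) ∧
      ∀ i : Fin (δ + 1), ∑ a ∈ S, w a * (a : ℝ) ^ (i.1 + 1) = y i := by
  simp only [IsLift, funext_iff, Finset.sum_apply, Pi.smul_apply, smul_eq_mul, momCurve]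

lemma momPts_eq_coe_image (δ : ℕ) (A : Finset ℕ) [DecidableEq (Fin δ → ℝ)] :
    momPts δ A = ((A.image fun a : ℕ => momCurve δ (a : ℝ)) : Set (Fin δ → ℝ)) := by
  simp [momPts]

lemma momCurve_natCast_injective {δ : ℕ} (hδ : 1 ≤ δ) :
    Function.Injective fun a : ℕ => momCurve δ (a : ℝ) := by
  intro a b h
  have := congrFun h ⟨0, hδ⟩
  simpa [momCurve] using this

lemma exists_isLift {δ : ℕ} (hδ : 1 ≤ δ) {S : Finset ℕ} {x : Fin δ → ℝ} (hx : x ∈ smp δ S) :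
    ∃ y, IsLift δ S x y := by
  classical
  rw [smp, momPts_eq_coe_image, Finset.mem_convexHull'] at hx
  obtain ⟨w, hw, hsum, hx⟩ := hx
  rw [Finset.sum_image (momCurve_natCast_injective hδ).injOn] at hsum hx
  exact ⟨_, fun a => w (momCurve δ a), fun a ha => hw _ (Finset.mem_image_of_mem _ ha), hsum, hx,
    rfl⟩

lemma IsLift.mem_smp {δ : ℕ} {S : Finset ℕ} {x : Fin δ → ℝ} {y : Fin (δ + 1) → ℝ}
    (h : IsLift δ S x y) : x ∈ smp δ S := by
  obtain ⟨w, hw, hsum, rfl, -⟩ := h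
  exact (convex_convexHull ℝ _).sum_mem hw hsum fun a ha =>
    subset_convexHull ℝ _ (Set.mem_image_of_mem _ ha)

lemma IsLift.mono {δ : ℕ} {R S : Finset ℕ} (hRS : R ⊆ S) {x : Fin δ → ℝ} {y : Fin (δ + 1) → ℝ}
    (h : IsLift δ R x y) : IsLift δ S x y := by
  obtain ⟨w, hw, hsum, hx, hy⟩ := h
  refine ⟨fun a => if a ∈ R then w a else 0, fun a _ => ?_, ?_, ?_, ?_⟩
  · dsimp only
    split_ifs with ha
    exacts [hw a ha, le_rfl]
  · simpa [Finset.sum_ite_mem, Finset.inter_eq_right.2 hRS] using hsum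
  · simpa [ite_smul, Finset.sum_ite_mem, Finset.inter_eq_right.2 hRS] using hx
  · simpa [ite_smul, Finset.sum_ite_mem, Finset.inter_eq_right.2 hRS] using hy

/-- Vandermonde: a vector indexed by `E` whose first `|E|` moments vanish is zero. -/
lemma eq_zero_of_moments_eq_zero {E : Finset ℕ} {u : ℕ → ℝ}
    (h : ∀ k < E.card, ∑ c ∈ E, u c * (c : ℝ) ^ k = 0) {c : ℕ} (hc : c ∈ E) : u c = 0 := by
  have hinj : Set.InjOn (fun a : ℕ => (a : ℝ)) E := Nat.cast_injective.injOn
  have key : ∑ a ∈ E, u a * (Lagrange.basis E (fun a : ℕ => (a : ℝ)) c).eval (a : ℝ) = 0 := by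
    simp_rw [Polynomial.eval_eq_sum_range, Lagrange.natDegree_basis hinj hc, Finset.mul_sum]
    rw [Finset.sum_comm]
    refine Finset.sum_eq_zero fun k hk => ?_
    have hk' : k < E.card := by
      have := Finset.card_pos.2 ⟨c, hc⟩
      have := Finset.mem_range.1 hk
      omega
    simp_rw [mul_left_comm (u _), ← Finset.mul_sum, h k hk', mul_zero]
  rw [Finset.sum_eq_single_of_mem c hc] at key
  · simpa [Lagrange.eval_basis_self hinj hc] using key
  · intro b hb hbc
    rw [Lagrange.eval_basis_of_ne (v := fun a : ℕ => (a : ℝ)) hbc.symm hb, mul_zero]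

lemma IsLift.unique {δ : ℕ} {S : Finset ℕ} (hS : S.card ≤ δ + 1) {x : Fin δ → ℝ}
    {y y' : Fin (δ + 1) → ℝ} (h : IsLift δ S x y) (h' : IsLift δ S x y') : y = y' := by
  obtain ⟨w, -, hw, hx, hy⟩ := isLift_iff.1 h
  obtain ⟨w', -, hw', hx', hy'⟩ := isLift_iff.1 h'
  have hz : ∀ c ∈ S, w c - w' c = 0 := fun c hc =>
    eq_zero_of_moments_eq_zero (u := fun c => w c - w' c) (fun k hk => by
      simp_rw [sub_mul, Finset.sum_sub_distrib]
      rcases k with _ | k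
      · simp [hw, hw']
      · have hk' : k < δ := by omega
        rw [hx ⟨k, hk'⟩, hx' ⟨k, hk'⟩, sub_self]) hc
  ext i
  rw [← hy, ← hy']
  exact Finset.sum_congr rfl fun c hc => by rw [sub_eq_zero.1 (hz c hc)]

/-- Every face of a triangulation is submerged by it. -/
lemma IsTriangulation.submerged_of_subset {m δ : ℕ} (hδ : 1 ≤ δ) {T : Finset (Finset ℕ)}
    (hT : IsTriangulation m δ T) {S A : Finset ℕ} (hS : S ∈ T) (hA : A ⊆ S) :
    Submerged δ T A := by
  rintro S₁ hS₁ x ⟨-, hx₁⟩ y y' hy hy'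
  have hx : x ∈ smp δ (S ∩ S₁) := by
    rw [← hT.2.2 S hS S₁ hS₁]
    exact ⟨(hy.mono hA).mem_smp, hx₁⟩
  obtain ⟨z, hz⟩ := exists_isLift hδ hx
  have h := (hy.mono hA).unique (hT.1 S hS).2.le (hz.mono Finset.inter_subset_left)
  have h' := hy'.unique (hT.1 S₁ hS₁).2.le (hz.mono Finset.inter_subset_right)
  rw [h, h']

/-- The divided-difference weights on `D ⊆ ℕ`. -/
def ddWeight (D : Finset ℕ) (c : ℕ) : ℝ := (∏ b ∈ D.erase c, ((c : ℝ) - b))⁻¹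

lemma ddWeight_ne_zero (D : Finset ℕ) (c : ℕ) : ddWeight D c ≠ 0 := by
  refine inv_ne_zero (Finset.prod_ne_zero_iff.2 fun b hb => ?_)
  exact sub_ne_zero.2 fun h => (Finset.mem_erase.1 hb).1 (Nat.cast_injective h).symm

lemma sum_ddWeight_mul_pow {D : Finset ℕ} {k : ℕ} (hk : k < D.card) :
    ∑ c ∈ D, ddWeight D c * (c : ℝ) ^ k = if k + 1 = D.card then 1 else 0 := by
  have h := Lagrange.coeff_eq_sum (s := D) (v := fun a : ℕ => (a : ℝ))
    Nat.cast_injective.injOn (P := (Polynomial.X : Polynomial ℝ) ^ k)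
    (by rw [Polynomial.degree_X_pow]; exact_mod_cast hk)
  simp only [Polynomial.coeff_X_pow, Polynomial.eval_pow, Polynomial.eval_X] at h
  have hiff : D.card - 1 = k ↔ k + 1 = D.card := by omega
  simp only [hiff] at h
  rw [h]
  exact Finset.sum_congr rfl fun c _ => by rw [ddWeight, mul_comm, div_eq_mul_inv]

/-- The divided-difference weights alternate in sign, the largest node having positive weight. -/
lemma card_filter_ddWeight (D : Finset ℕ) :
    (D.filter fun c => 0 < ddWeight D c).card = (D.card + 1) / 2 ∧
      (D.filter fun c => ddWeight D c < 0).card = D.card / 2 := by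
  induction D using Finset.induction_on_max with
  | empty => simp
  | insert a s ha ih =>
    have has : a ∉ s := fun h => (ha a h).false
    have htop : 0 < ddWeight (insert a s) a := by
      rw [ddWeight, Finset.erase_insert has]
      exact inv_pos.2 (Finset.prod_pos fun b hb => sub_pos.2 (by exact_mod_cast ha b hb))
    have hrec : ∀ c ∈ s, ddWeight (insert a s) c = ((c : ℝ) - a)⁻¹ * ddWeight s c := by
      intro c hc
      have hca : c ≠ a := (ha c hc).ne
      rw [ddWeight, Finset.erase_insert_of_ne hca.symm,
        Finset.prod_insert (fun h => has (Finset.mem_of_mem_erase h)), mul_inv, ddWeight]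
    have hneg : ∀ c ∈ s, ((c : ℝ) - a)⁻¹ < 0 := fun c hc =>
      inv_lt_zero.2 (sub_neg.2 (by exact_mod_cast ha c hc))
    have hpos' : (s.filter fun c => 0 < ddWeight (insert a s) c) =
        s.filter fun c => ddWeight s c < 0 :=
      Finset.filter_congr fun c hc => by
        simp [hrec c hc, mul_pos_iff, hneg c hc, (hneg c hc).not_gt]
    have hneg' : (s.filter fun c => ddWeight (insert a s) c < 0) =
        s.filter fun c => 0 < ddWeight s c :=
      Finset.filter_congr fun c hc => by
        simp [hrec c hc, mul_neg_iff, hneg c hc, (hneg c hc).not_gt]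
    rw [Finset.filter_insert, if_pos htop, Finset.filter_insert, if_neg htop.not_gt,
      Finset.card_insert_of_notMem (fun h => has (Finset.mem_of_mem_filter a h)),
      Finset.card_insert_of_notMem has, hpos', hneg', ih.1, ih.2]
    omega

/-- A vector whose moments of order `< n` vanish and whose `n`-th moment is positive is
sign-compatible with some divided difference on `n + 1` of its nodes. -/
lemma exists_conformal_ddWeight {n : ℕ} {E : Finset ℕ} {u : ℕ → ℝ}
    (h0 : ∀ k < n, ∑ c ∈ E, u c * (c : ℝ) ^ k = 0) (hn : 0 < ∑ c ∈ E, u c * (c : ℝ) ^ n) :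
    ∃ D ⊆ E, D.card = n + 1 ∧ ∀ c ∈ D, 0 < u c * ddWeight D c := by
  induction E using Finset.strongInduction generalizing u with
  | H E ih =>
    have herase : ∀ v : ℕ → ℝ, ∀ c ∈ E, v c = 0 → (∀ k < n, ∑ c ∈ E, v c * (c : ℝ) ^ k = 0) →
        0 < ∑ c ∈ E, v c * (c : ℝ) ^ n →
        ∃ D ⊆ E, D.card = n + 1 ∧ ∀ c ∈ D, 0 < v c * ddWeight D c := by
      intro v c hc hvc hv0 hvn
      have hs : ∀ k, ∑ b ∈ E.erase c, v b * (b : ℝ) ^ k = ∑ b ∈ E, v b * (b : ℝ) ^ k :=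
        fun k => Finset.sum_erase E (by rw [hvc, zero_mul])
      obtain ⟨D, hD, h⟩ := ih (E.erase c) (Finset.erase_ssubset hc) (u := v)
        (fun k hk => by rw [hs, hv0 k hk]) (by rwa [hs])
      exact ⟨D, hD.trans (Finset.erase_subset c E), h⟩
    by_cases hu : ∃ c ∈ E, u c = 0
    · obtain ⟨c, hc, huc⟩ := hu
      exact herase u c hc huc h0 hn
    push Not at hu
    have hcard : n + 1 ≤ E.card := by
      by_contra! hlt
      refine hn.ne' (Finset.sum_eq_zero fun c hc => ?_)
      rw [eq_zero_of_moments_eq_zero (fun k hk => h0 k (by omega)) hc, zero_mul]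
    obtain ⟨D, hDE, hD⟩ := Finset.exists_subset_card_eq hcard
    by_cases hall : ∀ c ∈ D, 0 < u c * ddWeight D c
    · exact ⟨D, hDE, hD, hall⟩
    push Not at hall
    obtain ⟨c₁, hc₁, hneg₁⟩ := hall
    have hmul : ∀ c ∈ D, u c * ddWeight D c ≠ 0 := fun c hc =>
      mul_ne_zero (hu c (hDE hc)) (ddWeight_ne_zero D c)
    obtain ⟨c₀, hc₀, hmin⟩ := (D.filter fun c => u c * ddWeight D c < 0).exists_min_image
      (fun c => -u c / ddWeight D c)
      ⟨c₁, Finset.mem_filter.2 ⟨hc₁, lt_of_le_of_ne hneg₁ (hmul c₁ hc₁)⟩⟩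
    obtain ⟨hc₀D, hneg₀⟩ := Finset.mem_filter.1 hc₀
    set t := -u c₀ / ddWeight D c₀ with ht
    have hdiv : ∀ c, -u c / ddWeight D c * (ddWeight D c) ^ 2 = -(u c * ddWeight D c) := by
      intro c
      field_simp [ddWeight_ne_zero D c]
    have htpos : 0 < t := by
      have h2 : 0 < (ddWeight D c₀) ^ 2 := by have := ddWeight_ne_zero D c₀; positivity
      have := hdiv c₀
      rw [← ht] at this
      exact pos_of_mul_pos_left (this ▸ neg_pos.2 hneg₀) h2.le
    let v : ℕ → ℝ := fun c => u c + t * if c ∈ D then ddWeight D c else 0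
    have hv : ∀ k, ∑ c ∈ E, v c * (c : ℝ) ^ k =
        ∑ c ∈ E, u c * (c : ℝ) ^ k + t * ∑ c ∈ D, ddWeight D c * (c : ℝ) ^ k := by
      intro k
      simp only [v, add_mul, Finset.sum_add_distrib, mul_assoc, ← Finset.mul_sum, ite_mul,
        zero_mul, Finset.sum_ite_mem, Finset.inter_eq_right.2 hDE]
    obtain ⟨D', hD'E, hD', hpos⟩ := herase v c₀ (hDE hc₀D)
      (by simp only [v, if_pos hc₀D, ht, div_mul_cancel₀ _ (ddWeight_ne_zero D c₀)]; ring)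
      (fun k hk => by
        rw [hv, h0 k hk, sum_ddWeight_mul_pow (by omega), if_neg (by omega)]; simp)
      (by
        rw [hv, sum_ddWeight_mul_pow (by omega), if_pos (by omega)]
        linarith)
    refine ⟨D', hD'E, hD', fun c hc => ?_⟩
    have huv : 0 ≤ u c * v c := by
      by_cases hcD : c ∈ D
      · have hvc : u c * v c = u c ^ 2 + t * (u c * ddWeight D c) := by
          simp only [v, if_pos hcD]; ring
        rw [hvc]
        rcases lt_or_ge (u c * ddWeight D c) 0 with hlt | hge
        · have h1 := mul_le_mul_of_nonpos_right (hmin c (Finset.mem_filter.2 ⟨hcD, hlt⟩)) hlt.le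
          have h2 : -u c / ddWeight D c * (u c * ddWeight D c) = -u c ^ 2 := by
            field_simp [ddWeight_ne_zero D c]
          linarith
        · positivity
      · simp only [v, if_neg hcD, mul_zero, add_zero]
        exact mul_self_nonneg _
    have hne : u c * v c ≠ 0 := mul_ne_zero (hu c (hD'E hc)) (left_ne_zero_of_mul (hpos c hc).ne')
    have hprod : 0 < v c ^ 2 * (u c * ddWeight D' c) := by
      have := mul_pos (lt_of_le_of_ne huv hne.symm) (hpos c hc)
      linarith [this, (by ring : u c * v c * (v c * ddWeight D' c) =
        v c ^ 2 * (u c * ddWeight D' c))]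
    exact pos_of_mul_pos_right hprod (sq_nonneg _)

/-- Two lifts of a point over different simplices at different heights give a circuit of the
cyclic polytope whose positive part `A` lies in the higher simplex, and a point where `|A|` has a
strictly higher lift than the lower simplex. -/
lemma exists_subset_lift_lt {δ : ℕ} {S S' : Finset ℕ} {x : Fin δ → ℝ}
    {y y' : Fin (δ + 1) → ℝ} (hy : IsLift δ S x y) (hy' : IsLift δ S' x y')
    (hlt : lastCoord y' < lastCoord y) :
    ∃ A ⊆ S, A.card = (δ + 1) / 2 + 1 ∧ ∃ x₁ z z', IsLift δ A x₁ z ∧ IsLift δ S' x₁ z' ∧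
      lastCoord z' < lastCoord z := by
  obtain ⟨w, hw, hw1, hwx, hwy⟩ := isLift_iff.1 hy
  obtain ⟨w', hw', hw1', hwx', hwy'⟩ := isLift_iff.1 hy'
  let u : ℕ → ℝ := fun c => (if c ∈ S then w c else 0) - if c ∈ S' then w' c else 0
  have hu : ∀ k, ∑ c ∈ S ∪ S', u c * (c : ℝ) ^ k =
      ∑ c ∈ S, w c * (c : ℝ) ^ k - ∑ c ∈ S', w' c * (c : ℝ) ^ k := by
    intro k
    simp only [u, sub_mul, Finset.sum_sub_distrib, ite_mul, zero_mul, Finset.sum_ite_mem,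
      Finset.union_inter_cancel_left, Finset.union_inter_cancel_right]
  have hlast : ∀ y : Fin (δ + 1) → ℝ, lastCoord y = y (Fin.last δ) := fun y => by
    simp [lastCoord, Fin.last]
  simp only [hlast] at hlt ⊢
  obtain ⟨D, -, hD, hpos⟩ := exists_conformal_ddWeight (n := δ + 1) (E := S ∪ S') (u := u)
    (fun k hk => by
      rw [hu]
      rcases k with _ | k
      · simp [hw1, hw1']
      · rw [hwx ⟨k, by omega⟩, hwx' ⟨k, by omega⟩, sub_self])
    (by
      rw [hu]
      have h1 := hwy (Fin.last δ)
      have h2 := hwy' (Fin.last δ)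
      simp only [Fin.val_last] at h1 h2
      rw [h1, h2]
      linarith)
  set A := D.filter fun c => 0 < ddWeight D c with hA
  set B := D.filter fun c => ddWeight D c < 0 with hB
  have hAS : A ⊆ S := by
    intro c hc
    obtain ⟨hcD, hg⟩ := Finset.mem_filter.1 hc
    have huc : 0 < u c := pos_of_mul_pos_left (hpos c hcD) hg.le
    by_contra hcS
    simp only [u, if_neg hcS] at huc
    split_ifs at huc with hcS'
    · linarith [hw' c hcS']
    · linarith
  have hBS : B ⊆ S' := by
    intro c hc
    obtain ⟨hcD, hg⟩ := Finset.mem_filter.1 hc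
    have huc : u c < 0 := by
      by_contra! hge
      exact (hpos c hcD).not_ge (mul_nonpos_of_nonneg_of_nonpos hge hg.le)
    by_contra hcS'
    simp only [u, if_neg hcS'] at huc
    split_ifs at huc with hcS
    · linarith [hw c hcS]
    · linarith
  have hAcard : A.card = (δ + 1) / 2 + 1 := by
    rw [(card_filter_ddWeight D).1, hD]
    omega
  set N := ∑ c ∈ A, ddWeight D c with hN
  have hNpos : 0 < N := Finset.sum_pos (fun c hc => (Finset.mem_filter.1 hc).2)
    (Finset.card_pos.1 (by omega))
  have hsplit : ∀ f : ℕ → ℝ, ∑ c ∈ D, ddWeight D c * f c =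
      ∑ c ∈ A, ddWeight D c * f c + ∑ c ∈ B, ddWeight D c * f c := by
    intro f
    rw [← Finset.sum_filter_add_sum_filter_not D fun c => 0 < ddWeight D c]
    congr 2
    refine Finset.filter_congr fun c _ => ?_
    rw [not_lt]
    exact ⟨fun h => lt_of_le_of_ne h (ddWeight_ne_zero D c), le_of_lt⟩
  have hmom : ∀ k, ∑ c ∈ A, ddWeight D c / N * (c : ℝ) ^ k =
      (∑ c ∈ A, ddWeight D c * (c : ℝ) ^ k) / N := fun k => by
    rw [Finset.sum_div]
    exact Finset.sum_congr rfl fun c _ => div_mul_eq_mul_div _ _ _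
  have hmom' : ∀ k, ∑ c ∈ B, -ddWeight D c / N * (c : ℝ) ^ k =
      (∑ c ∈ A, ddWeight D c * (c : ℝ) ^ k - ∑ c ∈ D, ddWeight D c * (c : ℝ) ^ k) / N :=
    fun k => by
      rw [hsplit, sub_add_cancel_left, ← Finset.sum_neg_distrib, Finset.sum_div]
      exact Finset.sum_congr rfl fun c _ => by ring
  have hlow : ∀ k < δ + 1, ∑ c ∈ B, -ddWeight D c / N * (c : ℝ) ^ k =
      ∑ c ∈ A, ddWeight D c / N * (c : ℝ) ^ k := fun k hk => by
    rw [hmom, hmom', sum_ddWeight_mul_pow (by omega), if_neg (by omega), sub_zero]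
  have hone : ∑ c ∈ A, ddWeight D c / N = 1 := by
    rw [← Finset.sum_div, ← hN, div_self hNpos.ne']
  refine ⟨A, hAS, hAcard, fun i => ∑ c ∈ A, ddWeight D c / N * (c : ℝ) ^ (i.1 + 1),
    fun i => ∑ c ∈ A, ddWeight D c / N * (c : ℝ) ^ (i.1 + 1),
    fun i => ∑ c ∈ B, -ddWeight D c / N * (c : ℝ) ^ (i.1 + 1), ?_, ?_, ?_⟩
  · exact isLift_iff.2 ⟨_, fun c hc => div_nonneg (Finset.mem_filter.1 hc).2.le hNpos.le, hone,
      fun _ => rfl, fun _ => rfl⟩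
  · refine IsLift.mono hBS (isLift_iff.2 ⟨fun c => -ddWeight D c / N, fun c hc =>
      div_nonneg (neg_nonneg.2 (Finset.mem_filter.1 hc).2.le) hNpos.le, ?_,
      fun i => hlow _ (by omega), fun _ => rfl⟩)
    simpa [hone] using hlow 0 (by omega)
  · simp only [Fin.val_last]
    rw [hmom, hmom', sum_ddWeight_mul_pow (by omega), if_pos (by omega)]
    exact div_lt_div_of_pos_right (by linarith) hNpos

/-- `T ≤₂ T'` iff every `(⌈δ/2⌉+1)`-element subset of `{1, …, m}` whose
simplex is submerged by `T` is also submerged by `T'`. -/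
theorem statement14 (δ m : ℕ) (hδ : 1 ≤ δ) (hm : δ + 1 ≤ m)
    (T T' : Finset (Finset ℕ))
    (hT : IsTriangulation m δ T) (hT' : IsTriangulation m δ T') :
    HST2 δ T T' ↔
      ∀ A : Finset ℕ, A ⊆ Finset.Icc 1 m → A.card = (δ + 1) / 2 + 1 →
        Submerged δ T A → Submerged δ T' A := by
  constructor
  · rintro h A hA - hsub S' hS' x ⟨hxA, hxS'⟩ y y' hy hy'
    have hx : x ∈ ⋃ S ∈ T, smp δ S := by
      rw [hT.2.1]
      exact convexHull_mono (Set.image_mono (by exact_mod_cast hA)) hxA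
    simp only [Set.mem_iUnion] at hx
    obtain ⟨S, hS, hxS⟩ := hx
    obtain ⟨z, hz⟩ := exists_isLift hδ hxS
    exact (hsub S hS x ⟨hxA, hxS⟩ y z hy hz).trans (h S hS S' hS' x ⟨hxS, hxS'⟩ z y' hz hy')
  · rintro h S hS S' hS' x - y y' hy hy'
    by_contra! hlt
    obtain ⟨A, hAS, hA, x₁, z, z', hz, hz', hzlt⟩ := exists_subset_lift_lt hy hy' hlt
    exact hzlt.not_ge (h A (hAS.trans (hT.1 S hS).1) hA (hT.submerged_of_subset hδ hS hAS) S' hS'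
      x₁ ⟨hz.mem_smp, hz'.mem_smp⟩ z z' hz hz')
end
end

section
/- Let d ≥ 1 and m ≥ 2d+2 be integers, let 𝒯 be a triangulation of the cyclic polytope C(m, 2d+1), and let A be a (d+1)-element subset of {1, …, m}. Then the d-simplex |A|_{2d+1} is supermerged by 𝒯 if and only if A is a face of 𝒯. -/
open Finset

noncomputable section

open Polynomial in
/-- Two weighted point systems on the moment curve with the same total weight and the same
weighted sum have the same weighted sum of values of any polynomial of degree at most `δ`. -/
theorem sum_mul_eval_eq_of_moments_eq {δ : ℕ} {S S' : Finset ℕ} {w w' : ℕ → ℝ}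
    (h0 : ∑ a ∈ S, w a = ∑ a ∈ S', w' a)
    (h1 : ∑ a ∈ S, w a • momCurve δ (a : ℝ) = ∑ a ∈ S', w' a • momCurve δ (a : ℝ))
    {q : ℝ[X]} (hq : q.natDegree ≤ δ) :
    ∑ a ∈ S, w a * q.eval (a : ℝ) = ∑ a ∈ S', w' a * q.eval (a : ℝ) := by
  have hmom : ∀ i < δ + 1, ∑ a ∈ S, w a * (a : ℝ) ^ i = ∑ a ∈ S', w' a * (a : ℝ) ^ i := by
    rintro (_ | i) hi
    · simpa using h0
    · simpa [momCurve] using congrFun h1 ⟨i, by omega⟩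
  have key : ∀ (U : Finset ℕ) (v : ℕ → ℝ), ∑ a ∈ U, v a * q.eval (a : ℝ) =
      ∑ i ∈ range (δ + 1), q.coeff i * ∑ a ∈ U, v a * (a : ℝ) ^ i := by
    intro U v
    simp_rw [eval_eq_sum_range' (Nat.lt_succ_of_le hq), mul_sum]
    rw [sum_comm]
    exact sum_congr rfl fun i _ => sum_congr rfl fun a _ => by ring
  rw [key, key]
  exact sum_congr rfl fun i hi => by rw [hmom i (mem_range.1 hi)]

open Polynomial in
/-- At most `δ + 1` points on the moment curve are affinely independent. -/
theorem eq_zero_of_sum_smul_momCurve_eq_zero {δ : ℕ} {S : Finset ℕ} {c : ℕ → ℝ}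
    (hS : S.card ≤ δ + 1) (h0 : ∑ a ∈ S, c a = 0)
    (h1 : ∑ a ∈ S, c a • momCurve δ (a : ℝ) = 0) {a : ℕ} (ha : a ∈ S) : c a = 0 := by
  have hdeg : (∏ b ∈ S.erase a, (X - C (b : ℝ))).natDegree ≤ δ := by
    rw [natDegree_finsetProd_X_sub_C_eq_card, card_erase_of_mem ha]
    omega
  have h := sum_mul_eval_eq_of_moments_eq (S := S) (S' := ∅) (w := c) (w' := c)
    (by simpa using h0) (by simpa using h1) hdeg
  rw [sum_empty, sum_eq_single_of_mem a ha] at h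
  · refine (mul_eq_zero.1 h).resolve_right ?_
    rw [eval_prod]
    refine prod_ne_zero_iff.2 fun b hb => ?_
    simpa [sub_eq_zero] using (ne_of_mem_erase hb).symm
  · intro b hb hba
    rw [eval_prod, prod_eq_zero (mem_erase.2 ⟨hba, hb⟩) (by simp), mul_zero]

/-- Uniqueness of barycentric coordinates: if a point of a simplex is also a combination of a
subset of the vertices, the weights agree. -/
theorem weights_eq_of_subset {δ : ℕ} {S R : Finset ℕ} {w v : ℕ → ℝ} (hS : S.card ≤ δ + 1)
    (hR : R ⊆ S) (h0 : ∑ a ∈ S, w a = ∑ a ∈ R, v a)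
    (h1 : ∑ a ∈ S, w a • momCurve δ (a : ℝ) = ∑ a ∈ R, v a • momCurve δ (a : ℝ)) {a : ℕ}
    (ha : a ∈ S) : w a = if a ∈ R then v a else 0 := by
  have hinter : S ∩ R = R := inter_eq_right.2 hR
  refine sub_eq_zero.1 (eq_zero_of_sum_smul_momCurve_eq_zero
    (c := fun a => w a - if a ∈ R then v a else 0) hS ?_ ?_ ha)
  · simp [sum_sub_distrib, h0, sum_ite_mem, hinter]
  · simp [sub_smul, sum_sub_distrib, h1, ite_smul, sum_ite_mem, hinter]

theorem mem_smp_iff {δ : ℕ} {S : Finset ℕ} {x : Fin δ → ℝ} :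
    x ∈ smp δ S ↔ ∃ w : ℕ → ℝ, (∀ a ∈ S, 0 ≤ w a) ∧ ∑ a ∈ S, w a = 1 ∧
      ∑ a ∈ S, w a • momCurve δ (a : ℝ) = x := by
  constructor
  · intro hx
    refine convexHull_min (t := {x | ∃ w : ℕ → ℝ, (∀ a ∈ S, 0 ≤ w a) ∧ ∑ a ∈ S, w a = 1 ∧
      ∑ a ∈ S, w a • momCurve δ (a : ℝ) = x}) ?_ ?_ hx
    · rintro _ ⟨a, ha, rfl⟩
      have ha' : a ∈ S := ha
      exact ⟨fun b => if b = a then 1 else 0, fun b _ => by dsimp only; split_ifs <;> simp,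
        by simp [ha'], by simp [ite_smul, ha']⟩
    · rintro _ ⟨u, hu, hu1, rfl⟩ _ ⟨v, hv, hv1, rfl⟩ s t hs ht hst
      refine ⟨fun a => s * u a + t * v a, fun a ha => ?_, ?_, ?_⟩
      · exact add_nonneg (mul_nonneg hs (hu a ha)) (mul_nonneg ht (hv a ha))
      · rw [sum_add_distrib, ← mul_sum, ← mul_sum, hu1, hv1, mul_one, mul_one, hst]
      · simp [add_smul, sum_add_distrib, mul_smul, smul_sum]
  · rintro ⟨w, hw, hw1, rfl⟩
    exact (convex_convexHull ℝ _).sum_mem hw hw1 fun a ha =>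
      subset_convexHull ℝ _ ⟨a, ha, rfl⟩

theorem smp_mono {δ : ℕ} {S S' : Finset ℕ} (h : S ⊆ S') : smp δ S ⊆ smp δ S' :=
  convexHull_mono (Set.image_mono (coe_subset.2 h))

theorem lastCoord_sum_smul_momCurve (δ : ℕ) (S : Finset ℕ) (w : ℕ → ℝ) :
    lastCoord (∑ a ∈ S, w a • momCurve (δ + 1) (a : ℝ)) = ∑ a ∈ S, w a * (a : ℝ) ^ (δ + 1) := by
  simp [lastCoord, momCurve]

/-- If a point of a `d`-simplex on the vertices `A` has a representation by other points of the
moment curve whose lift is not higher, then that representation only uses vertices in `A`. -/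
theorem weight_eq_zero_of_lift_le {d : ℕ} {A S : Finset ℕ} {l w : ℕ → ℝ} (hA : A.card = d + 1)
    (hw : ∀ a ∈ S, 0 ≤ w a) (h0 : ∑ a ∈ S, w a = ∑ a ∈ A, l a)
    (h1 : ∑ a ∈ S, w a • momCurve (2 * d + 1) (a : ℝ) =
      ∑ a ∈ A, l a • momCurve (2 * d + 1) (a : ℝ))
    (hle : ∑ a ∈ S, w a * (a : ℝ) ^ (2 * d + 1 + 1) ≤ ∑ a ∈ A, l a * (a : ℝ) ^ (2 * d + 1 + 1))
    {s : ℕ} (hs : s ∈ S) (hsA : s ∉ A) : w s = 0 := by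
  set q : Polynomial ℝ := (∏ b ∈ A, (Polynomial.X - Polynomial.C (b : ℝ))) ^ 2 with hq
  have heval : ∀ a : ℕ, q.eval (a : ℝ) = (∏ b ∈ A, ((a : ℝ) - b)) ^ 2 := fun a => by
    simp [hq, Polynomial.eval_prod]
  have hmonic : q.Monic := (Polynomial.monic_prod_X_sub_C _ _).pow 2
  have hqdeg : q.natDegree = 2 * d + 1 + 1 := by
    rw [hq, Polynomial.natDegree_pow, Polynomial.natDegree_finsetProd_X_sub_C_eq_card, hA]
    ring
  have hdeg : (q - Polynomial.X ^ (2 * d + 1 + 1)).natDegree ≤ 2 * d + 1 :=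
    Nat.lt_succ_iff.1 (Polynomial.IsMonicOfDegree.natDegree_sub_X_pow (Nat.succ_ne_zero _)
      ⟨hqdeg, hmonic⟩)
  have h := sum_mul_eval_eq_of_moments_eq h0 h1 hdeg
  simp only [Polynomial.eval_sub, Polynomial.eval_pow, Polynomial.eval_X, mul_sub,
    sum_sub_distrib] at h
  have hAq : ∑ a ∈ A, l a * q.eval (a : ℝ) = 0 := sum_eq_zero fun a ha => by
    rw [heval, prod_eq_zero ha (sub_self _)]
    simp
  have hnn : ∀ a ∈ S, 0 ≤ w a * q.eval (a : ℝ) := fun a ha => by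
    rw [heval]
    exact mul_nonneg (hw a ha) (sq_nonneg _)
  have hz : ∑ a ∈ S, w a * q.eval (a : ℝ) = 0 :=
    le_antisymm (by linarith) (sum_nonneg hnn)
  refine (mul_eq_zero.1 ((sum_eq_zero_iff_of_nonneg hnn).1 hz s hs)).resolve_right ?_
  rw [heval]
  refine pow_ne_zero 2 (prod_ne_zero_iff.2 fun b hb => ?_)
  rw [sub_ne_zero, Nat.cast_injective.ne_iff]
  rintro rfl
  exact hsA hb

/-- a `d`-simplex in `C(m, 2d+1)` is supermerged by a triangulation `T`
iff it is a face of `T`. -/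
theorem statement15 (d m : ℕ) (hd : 1 ≤ d) (hm : 2 * d + 2 ≤ m)
    (T : Finset (Finset ℕ)) (hT : IsTriangulation m (2 * d + 1) T)
    (A : Finset ℕ) (hA : A ⊆ Finset.Icc 1 m) (hAc : A.card = d + 1) :
    Supermerged (2 * d + 1) T A ↔ IsFace T A := by
  obtain ⟨hTS, hTU, hTI⟩ := hT
  constructor
  · intro hsup
    have hpos : (0 : ℝ) < d + 1 := by positivity
    have hl1 : ∑ _a ∈ A, ((d : ℝ) + 1)⁻¹ = 1 := by
      rw [sum_const, hAc, nsmul_eq_mul]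
      push_cast
      exact mul_inv_cancel₀ hpos.ne'
    set l : ℕ → ℝ := fun _ => ((d : ℝ) + 1)⁻¹
    have hl0 : ∀ a, 0 < l a := fun _ => inv_pos.2 hpos
    set x := ∑ a ∈ A, l a • momCurve (2 * d + 1) (a : ℝ) with hx
    have hxA : x ∈ smp (2 * d + 1) A := mem_smp_iff.2 ⟨l, fun a _ => (hl0 a).le, hl1, rfl⟩
    have hxT : x ∈ ⋃ S ∈ T, smp (2 * d + 1) S := hTU ▸ smp_mono hA hxA
    obtain ⟨S, hS, hxS⟩ := Set.mem_iUnion₂.1 hxT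
    obtain ⟨w, hw0, hw1, hwx⟩ := mem_smp_iff.1 hxS
    have hle := hsup S hS x ⟨hxA, hxS⟩ _ _ ⟨l, fun a _ => (hl0 a).le, hl1, rfl, rfl⟩
      ⟨w, hw0, hw1, hwx, rfl⟩
    rw [lastCoord_sum_smul_momCurve, lastCoord_sum_smul_momCurve] at hle
    have hzero : ∀ s ∈ S, s ∉ S ∩ A → w s = 0 := fun s hs hsA =>
      weight_eq_zero_of_lift_le hAc hw0 (hw1.trans hl1.symm) hwx hle hs
        fun h => hsA (mem_inter.2 ⟨hs, h⟩)
    refine ⟨S, hS, fun a ha => ?_⟩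
    by_contra haS
    have hla := weights_eq_of_subset (δ := 2 * d + 1) (w := l) (v := w)
      (by omega) (inter_subset_right (s₁ := S))
      (by rw [hl1, sum_subset inter_subset_left hzero, hw1])
      (by rw [← hx, ← hwx, sum_subset inter_subset_left fun s hs h => by
            rw [hzero s hs h, zero_smul]]) ha
    rw [if_neg fun h => haS (mem_inter.1 h).1] at hla
    exact (hl0 a).ne' hla
  · rintro ⟨S₀, hS₀, hAS₀⟩ S hS x ⟨hxA, hxS⟩ y y' ⟨l, -, hl1, hlx, rfl⟩ ⟨w, -, hw1, hwx, rfl⟩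
    have hxI : x ∈ smp (2 * d + 1) (S₀ ∩ S) := hTI S₀ hS₀ S hS ▸ ⟨smp_mono hAS₀ hxA, hxS⟩
    obtain ⟨v, -, hv1, hvx⟩ := mem_smp_iff.1 hxI
    have hw := fun a (ha : a ∈ S) => weights_eq_of_subset (hTS S hS).2.le inter_subset_right
      (hw1.trans hv1.symm) (hwx.trans hvx.symm) ha
    have hl : ∀ a ∈ S₀, (if a ∈ S₀ ∩ S then v a else 0) = if a ∈ A then l a else 0 :=
      fun a ha => by
        refine weights_eq_of_subset (hTS S₀ hS₀).2.le hAS₀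
          (w := fun a => if a ∈ S₀ ∩ S then v a else 0) ?_ ?_ ha
        · simpa only [sum_ite_mem, inter_eq_right.2 inter_subset_left]
            using hv1.trans hl1.symm
        · simpa only [ite_smul, zero_smul, sum_ite_mem, inter_eq_right.2 inter_subset_left]
            using hvx.trans hlx.symm
    refine le_of_eq (congrArg lastCoord ?_)
    calc ∑ a ∈ S, w a • momCurve (2 * d + 1 + 1) (a : ℝ)
        = ∑ a ∈ S, (if a ∈ S₀ ∩ S then v a else 0) • momCurve (2 * d + 1 + 1) (a : ℝ) :=
          sum_congr rfl fun a ha => by rw [hw a ha]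
      _ = ∑ a ∈ S₀ ∩ S, v a • momCurve (2 * d + 1 + 1) (a : ℝ) := by
          simp only [ite_smul, zero_smul, sum_ite_mem, inter_eq_right.2 inter_subset_right]
      _ = ∑ a ∈ S₀, (if a ∈ S₀ ∩ S then v a else 0) • momCurve (2 * d + 1 + 1) (a : ℝ) := by
          simp only [ite_smul, zero_smul, sum_ite_mem, inter_eq_right.2 inter_subset_left]
      _ = ∑ a ∈ S₀, (if a ∈ A then l a else 0) • momCurve (2 * d + 1 + 1) (a : ℝ) :=
          sum_congr rfl fun a ha => by rw [hl a ha]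
      _ = ∑ a ∈ A, l a • momCurve (2 * d + 1 + 1) (a : ℝ) := by
          simp only [ite_smul, zero_smul, sum_ite_mem, inter_eq_right.2 hAS₀]
end
end
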